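/- The family of dynamically syndetic subsets of ℕ and the family of dynamically central syndetic subsets of ℕ (which are the duals of the families of dynamically thick sets and of sets of pointwise recurrence, respectively) are not σ-compact. -/

import Mathlib

/-- A topological dynamical system: a nonempty compact metric space together with a
continuous self-map. -/
structure MetricDynSystem where
  carrier : Type
  [metric : MetricSpace carrier]
  [cpt : CompactSpace carrier]
  [carrier_nonempty : Nonempty carrier]
  map : carrier → carrier
  continuous_map : Continuous map

attribute [instance] MetricDynSystem.metric MetricDynSystem.cpt MetricDynSystem.carrier_nonempty

/-- A system is minimal if every point has dense forward orbit `{T^n x : n ∈ ℕ}`. -/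
def MetricDynSystem.Minimal (S : MetricDynSystem) : Prop :=
  ∀ x : S.carrier, Dense {y : S.carrier | ∃ n : ℕ, 0 < n ∧ S.map^[n] x = y}

/-- `R(x, U)`: the set of (positive) times at which `x` visits `U`. -/
def RetTimes (S : MetricDynSystem) (x : S.carrier) (U : Set S.carrier) : Set ℕ :=
  {n : ℕ | 0 < n ∧ S.map^[n] x ∈ U}

/-- `A` is a set of pointwise recurrence: for every minimal system, every point `x` and
every open neighborhood `U` of `x`, some `n ∈ A` has `T^n x ∈ U`. -/
def PointwiseRecurrent (A : Set ℕ) : Prop :=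
  ∀ S : MetricDynSystem, S.Minimal →
    ∀ (x : S.carrier) (U : Set S.carrier), IsOpen U → x ∈ U →
      ∃ n ∈ A, 0 < n ∧ S.map^[n] x ∈ U

/-- `A` is dynamically thick: for every minimal system, every point `x` and every
nonempty open `U`, some `n ∈ A` has `T^n x ∈ U`. -/
def DynThick (A : Set ℕ) : Prop :=
  ∀ S : MetricDynSystem, S.Minimal →
    ∀ (x : S.carrier) (U : Set S.carrier), IsOpen U → U.Nonempty →
      ∃ n ∈ A, 0 < n ∧ S.map^[n] x ∈ U

/-- `A` is dynamically syndetic: it contains a set of return times `R(x, U)` for a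
minimal system and a nonempty open `U`. -/
def DynSyndetic (A : Set ℕ) : Prop :=
  ∃ S : MetricDynSystem, S.Minimal ∧
    ∃ (x : S.carrier) (U : Set S.carrier), IsOpen U ∧ U.Nonempty ∧ RetTimes S x U ⊆ A

/-- `A` is dynamically central syndetic: it contains a set of return times `R(x, U)` for
a minimal system and an open `U` containing `x`. -/
def DynCentralSyndetic (A : Set ℕ) : Prop :=
  ∃ S : MetricDynSystem, S.Minimal ∧
    ∃ (x : S.carrier) (U : Set S.carrier), IsOpen U ∧ x ∈ U ∧ RetTimes S x U ⊆ A

/-- A family of subsets of `ℕ`: an upward-closed collection. -/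
def UpwardClosed (F : Set (Set ℕ)) : Prop := ∀ ⦃A B : Set ℕ⦄, A ∈ F → A ⊆ B → B ∈ F

/-- The dual family `F*`: all sets meeting every member of `F`. -/
def dualFamily (F : Set (Set ℕ)) : Set (Set ℕ) := {B : Set ℕ | ∀ A ∈ F, (A ∩ B).Nonempty}

/-- A family `G` is compact if for every `B ∈ G*` there is `M` with `B ∩ {1, …, M} ∈ G*`. -/
def CompactFamily (G : Set (Set ℕ)) : Prop :=
  UpwardClosed G ∧ ∀ B ∈ dualFamily G, ∃ M : ℕ, B ∩ Set.Icc 1 M ∈ dualFamily G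

/-- A family is σ-compact if it is a union of countably many compact families. -/
def SigmaCompactFamily (G : Set (Set ℕ)) : Prop :=
  ∃ Gs : ℕ → Set (Set ℕ), (∀ n, CompactFamily (Gs n)) ∧ G = ⋃ n, Gs n

open Set Topology

/-! ### Return times in minimal systems along arithmetic progressions -/

theorem DynCentralSyndetic.dynSyndetic {A : Set ℕ} (h : DynCentralSyndetic A) :
    DynSyndetic A := by
  obtain ⟨S, hS, x, U, hU, hx, hR⟩ := h
  exact ⟨S, hS, x, U, hU, ⟨x, hx⟩, hR⟩

/-- Every continuous self-map of a nonempty compact space has a minimal nonempty closed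
forward-invariant set. -/
theorem exists_minimal_closed_invariant {X : Type*} [TopologicalSpace X] [CompactSpace X]
    [Nonempty X] (f : X → X) :
    ∃ K : Set X, IsClosed K ∧ K.Nonempty ∧ MapsTo f K K ∧
      ∀ K' ⊆ K, IsClosed K' → K'.Nonempty → MapsTo f K' K' → K' = K := by
  obtain ⟨K, hK⟩ := zorn_superset
    {K : Set X | IsClosed K ∧ K.Nonempty ∧ MapsTo f K K} (by
      intro c hc hchain
      rcases c.eq_empty_or_nonempty with rfl | hne
      · exact ⟨univ, ⟨isClosed_univ, univ_nonempty, mapsTo_univ _ _⟩, by simp⟩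
      · refine ⟨⋂₀ c, ⟨isClosed_sInter fun s hs => (hc hs).1, ?_, ?_⟩,
          fun s hs => sInter_subset_of_mem hs⟩
        · have : Nonempty c := hne.to_subtype
          have hdir : DirectedOn (fun s t : Set X => s ⊇ t) c :=
            IsChain.directedOn (r := fun s t : Set X => s ⊇ t) hchain.symm
          exact IsCompact.nonempty_sInter_of_directed_nonempty_isCompact_isClosed hdir
            (fun s hs => (hc hs).2.1) (fun s hs => (hc hs).1.isCompact) fun s hs => (hc hs).1
        · intro x hx s hs
          exact (hc hs).2.2 (hx s hs))
  refine ⟨K, hK.prop.1, hK.prop.2.1, hK.prop.2.2, fun K' hsub hcl hne hmaps => ?_⟩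
  exact Subset.antisymm hsub (hK.le_of_le ⟨hcl, hne, hmaps⟩ hsub)

/-- In a minimal system, if `x` visits the open set `U` at time `n`, then it does so with
bounded gaps along the arithmetic progression of step `L` through `n`. -/
theorem MetricDynSystem.Minimal.exists_bound_visit {S : MetricDynSystem} (hS : S.Minimal)
    {L : ℕ} (hL : 0 < L) {x : S.carrier} {U : Set S.carrier} (hU : IsOpen U) {n : ℕ}
    (hn : S.map^[n] x ∈ U) :
    ∃ J : ℕ, ∀ p : ℕ, ∃ j ≤ J, S.map^[L * (p + j) + n] x ∈ U := by
  obtain ⟨K, hKc, ⟨k₀, hk₀⟩, hKm, hKmin⟩ := exists_minimal_closed_invariant (S.map^[L])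
  have hiter : ∀ q, MapsTo (S.map^[L * q]) K K := fun q => by
    rw [Function.iterate_mul]; exact hKm.iterate q
  have hcont : ∀ m, Continuous (S.map^[m]) := fun m => S.continuous_map.iterate m
  obtain ⟨i, k, hk, rfl⟩ : ∃ i, ∃ k ∈ K, S.map^[i] k = x := by
    have hcl : IsClosed (⋃ i ∈ Finset.range L, S.map^[i] '' K) :=
      isClosed_biUnion_finset fun i _ => (hKc.isCompact.image (hcont i)).isClosed
    have hsub : {y : S.carrier | ∃ n : ℕ, 0 < n ∧ S.map^[n] k₀ = y} ⊆
        ⋃ i ∈ Finset.range L, S.map^[i] '' K := by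
      rintro _ ⟨m, -, rfl⟩
      refine mem_biUnion (x := m % L) (by simpa using Nat.mod_lt m hL)
        ⟨S.map^[L * (m / L)] k₀, hiter _ hk₀, ?_⟩
      rw [← Function.iterate_add_apply, Nat.mod_add_div]
    have hx := closure_minimal hsub hcl ((hS k₀) x)
    simp only [mem_iUnion, mem_image] at hx
    obtain ⟨i, -, k, hk, h⟩ := hx
    exact ⟨i, k, hk, h⟩
  set V := S.map^[n + i] ⁻¹' U with hV
  have hVo : IsOpen V := hU.preimage (hcont _)
  have hkV : k ∈ V := by
    rw [hV, mem_preimage, Function.iterate_add_apply]; exact hn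
  have hvisit : ∀ z ∈ K, ∃ j, S.map^[L * j] z ∈ V := by
    intro z hz
    have hrange : range (fun j => S.map^[L * j] z) ⊆ K := by
      rintro _ ⟨j, rfl⟩; exact hiter j hz
    have heq : closure (range fun j => S.map^[L * j] z) = K := by
      refine hKmin _ (closure_minimal hrange hKc) isClosed_closure
        ⟨_, subset_closure ⟨0, rfl⟩⟩ (MapsTo.closure ?_ (hcont L))
      rintro _ ⟨j, rfl⟩
      refine ⟨j + 1, ?_⟩
      simp only [← Function.iterate_add_apply]
      congr 1
      ring
    rw [← heq] at hk
    obtain ⟨_, hV', j, rfl⟩ := mem_closure_iff.1 hk V hVo hkV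
    exact ⟨j, hV'⟩
  obtain ⟨t, ht⟩ := hKc.isCompact.elim_finite_subcover (fun j => S.map^[L * j] ⁻¹' V)
    (fun j => hVo.preimage (hcont _)) fun z hz => mem_iUnion.2 (hvisit z hz)
  refine ⟨t.sup id, fun p => ?_⟩
  have hp := ht (hiter p hk)
  simp only [mem_iUnion, mem_preimage] at hp
  obtain ⟨j, hj, hjV⟩ := hp
  refine ⟨j, Finset.le_sup (f := id) hj, ?_⟩
  simp only [hV, mem_preimage, ← Function.iterate_add_apply] at hjV ⊢
  convert hjV using 2
  ring

/-- A set which avoids each residue class modulo `L` on arbitrarily long intervals is not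
dynamically syndetic. -/
theorem not_dynSyndetic_of_avoids_residues {A : Set ℕ} {L : ℕ} (hL : 0 < L)
    (h : ∀ r < L, ∀ N, ∃ a, ∀ m, a ≤ m → m ≤ a + N → m % L = r → m ∉ A) :
    ¬ DynSyndetic A := by
  rintro ⟨S, hS, x, U, hU, hne, hR⟩
  obtain ⟨_, hyU, n, hn, rfl⟩ := (hS x).inter_open_nonempty U hU hne
  obtain ⟨J, hJ⟩ := hS.exists_bound_visit hL hU hyU
  obtain ⟨a, ha⟩ := h (n % L) (Nat.mod_lt n hL) (n + L * (J + 1))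
  obtain ⟨j, hj, hjU⟩ := hJ (a / L + 1)
  have h1 := Nat.div_add_mod a L
  have h2 := Nat.mod_lt a hL
  have h3 : L * j ≤ L * J := Nat.mul_le_mul_left L hj
  have h4 : L * (a / L + 1 + j) = L * (a / L) + L + L * j := by ring
  have h5 : L * (J + 1) = L * J + L := by ring
  refine ha (L * (a / L + 1 + j) + n) (by omega) (by omega) ?_ (hR ⟨by omega, hjU⟩)
  simp

/-! ### Uniformly recurrent sequences -/

/-- A sequence is uniformly recurrent if each of its prefixes reappears with bounded gaps. -/
def UniformlyRecurrent (x : ℕ → Bool) : Prop :=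
  ∀ n, ∃ g, ∀ a, ∃ j ≤ g, ∀ i < n, x (a + j + i) = x i

/-- The `a`-th shift of a sequence. -/
def shiftSeq (a : ℕ) (x : ℕ → Bool) : ℕ → Bool := fun i => x (a + i)

theorem continuous_shiftSeq (a : ℕ) : Continuous (shiftSeq a) :=
  continuous_pi fun i => continuous_apply (a + i)

theorem mem_closure_iff_exists_agree {s : Set (ℕ → Bool)} {z : ℕ → Bool} :
    z ∈ closure s ↔ ∀ n, ∃ y ∈ s, ∀ i < n, y i = z i := by
  constructor
  · intro hz n
    obtain ⟨y, hy, hys⟩ := mem_closure_iff.1 hz (PiNat.cylinder z n)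
      (PiNat.isOpen_cylinder _ z n) (PiNat.self_mem_cylinder z n)
    exact ⟨y, hys, fun i hi => hy i hi⟩
  · intro h
    rw [(PiNat.isTopologicalBasis_cylinders (fun _ : ℕ => Bool)).mem_closure_iff]
    rintro _ ⟨w, n, rfl⟩ hz
    obtain ⟨y, hys, hy⟩ := h n
    exact ⟨y, fun i hi => (hy i hi).trans (hz i hi), hys⟩

/-- The orbit closure of a sequence under the shift. -/
abbrev orbitClosure (x : ℕ → Bool) : Set (ℕ → Bool) := closure (range fun a => shiftSeq a x)

theorem mapsTo_orbitClosure (x : ℕ → Bool) :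
    MapsTo (shiftSeq 1) (orbitClosure x) (orbitClosure x) := by
  refine MapsTo.closure ?_ (continuous_shiftSeq 1)
  rintro _ ⟨a, rfl⟩
  exact ⟨a + 1, funext fun i => congrArg x (add_assoc a 1 i)⟩

/-- The shift on the orbit closure of a sequence. -/
def orbitShift (x : ℕ → Bool) : orbitClosure x → orbitClosure x :=
  (mapsTo_orbitClosure x).restrict

theorem orbitShift_iterate (x : ℕ → Bool) (n : ℕ) (y : orbitClosure x) (i : ℕ) :
    ((orbitShift x)^[n] y).1 i = y.1 (n + i) := by
  induction n generalizing i with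
  | zero => simp
  | succ n ih =>
    rw [Function.iterate_succ_apply']
    exact (ih (1 + i)).trans (congrArg y.1 (by ring))

theorem UniformlyRecurrent.dense_orbit {x : ℕ → Bool} (hx : UniformlyRecurrent x)
    (y : orbitClosure x) : Dense {z | ∃ n : ℕ, 0 < n ∧ (orbitShift x)^[n] y = z} := by
  intro z
  rw [closure_subtype, mem_closure_iff_exists_agree]
  intro n
  obtain ⟨_, ⟨b, rfl⟩, hb⟩ := mem_closure_iff_exists_agree.1 z.2 n
  obtain ⟨g, hg⟩ := hx (b + n)
  obtain ⟨_, ⟨a, rfl⟩, ha⟩ := mem_closure_iff_exists_agree.1 y.2 (1 + g + (b + n))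
  obtain ⟨j, hj, hji⟩ := hg (a + 1)
  refine ⟨_, ⟨_, ⟨1 + j + b, by omega, rfl⟩, rfl⟩, fun i hi => ?_⟩
  rw [orbitShift_iterate, ← ha _ (by omega), ← hb i hi]
  simp only [shiftSeq]
  rw [← hji (b + i) (by omega)]
  congr 1
  ring

/-- The shift on the orbit closure of a sequence, as a dynamical system. -/
noncomputable def orbitClosureSystem (x : ℕ → Bool) : MetricDynSystem where
  carrier := orbitClosure x
  metric := TopologicalSpace.metrizableSpaceMetric _
  cpt := isCompact_iff_compactSpace.1 isClosed_closure.isCompact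
  carrier_nonempty := ⟨⟨_, subset_closure ⟨0, rfl⟩⟩⟩
  map := orbitShift x
  continuous_map := (continuous_shiftSeq 1).restrict (mapsTo_orbitClosure x)

theorem UniformlyRecurrent.dynCentralSyndetic {x : ℕ → Bool} (hx : UniformlyRecurrent x)
    (h0 : x 0 = true) : DynCentralSyndetic {n | x n = true} := by
  let x' : orbitClosure x := ⟨x, subset_closure ⟨0, funext fun i => congrArg x (zero_add i)⟩⟩
  have hcont : Continuous fun y : orbitClosure x => y.1 0 :=
    (continuous_apply 0).comp continuous_subtype_val
  have hopen : IsOpen {y : orbitClosure x | y.1 0 = true} :=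
    (isOpen_discrete {true}).preimage hcont
  refine ⟨orbitClosureSystem x, hx.dense_orbit, x', {y : orbitClosure x | y.1 0 = true},
    hopen, h0, ?_⟩
  rintro n ⟨-, hn⟩
  exact (orbitShift_iterate x n x' 0).symm.trans hn

/-! ### Compact families -/

/-- The complement of a compact family is open in the product topology. -/
theorem CompactFamily.exists_forall_agree_notMem {G : Set (Set ℕ)} (hG : CompactFamily G)
    {b : ℕ → Bool}
    (hb : {n | b n = true} ∉ G) :
    ∃ M, ∀ x : ℕ → Bool, (∀ i ≤ M, x i = b i) → {n | x n = true} ∉ G := by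
  have hdual : {n | b n = true}ᶜ ∈ dualFamily G := by
    intro A hA
    by_contra hcon
    exact hb (hG.1 hA (disjoint_compl_right_iff_subset.1
      (disjoint_iff_inter_eq_empty.2 (not_nonempty_iff_eq_empty.1 hcon))))
  obtain ⟨M, hM⟩ := hG.2 _ hdual
  refine ⟨M, fun x hx hxG => ?_⟩
  obtain ⟨n, hnx, hnb, hnM⟩ := hM _ hxG
  exact hnb ((hx n hnM.2).symm.trans hnx)

/-! ### The diagonal construction -/

/-- A set of words of a common length `len`, represented by a set of sequences determined by
their first `len` terms, such that each position carries the value `false` in some word,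
together with a distinguished word starting with `true`. -/
structure WordFamily where
  len : ℕ
  words : Set (ℕ → Bool)
  base : ℕ → Bool
  len_pos : 0 < len
  saturated : ∀ u ∈ words, ∀ v : ℕ → Bool, (∀ i < len, v i = u i) → v ∈ words
  base_mem : base ∈ words
  base_zero : base 0 = true
  exists_false : ∀ r < len, ∃ u ∈ words, u r = false

namespace WordFamily

/-- There is an infinite concatenation of words of `s`, starting with the distinguished one,
which is not dynamically syndetic. -/
theorem exists_not_dynSyndetic (s : WordFamily) :
    ∃ b : ℕ → Bool, (∀ i < s.len, b i = s.base i) ∧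
      (∀ q, shiftSeq (q * s.len) b ∈ s.words) ∧ ¬ DynSyndetic {n | b n = true} := by
  have hL := s.len_pos
  choose! u huW hu using s.exists_false
  refine ⟨fun i => if i < s.len then s.base i else
    u (Nat.sqrt (i / s.len) % s.len) (i % s.len), fun i hi => if_pos hi, fun q => ?_,
    not_dynSyndetic_of_avoids_residues hL fun r hr N => ?_⟩
  · rcases q.eq_zero_or_pos with rfl | hq
    · refine s.saturated _ s.base_mem _ fun i hi => ?_
      simp [shiftSeq, hi]
    · refine s.saturated _ (huW (Nat.sqrt q % s.len) (Nat.mod_lt _ hL)) _ fun i hi => ?_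
      have h1 : ¬ q * s.len + i < s.len := by nlinarith
      have h2 : (q * s.len + i) / s.len = q := by
        rw [mul_comm, Nat.mul_add_div hL, Nat.div_eq_of_lt hi, add_zero]
      have h3 : (q * s.len + i) % s.len = i := by
        rw [mul_comm, Nat.mul_add_mod, Nat.mod_eq_of_lt hi]
      simp [shiftSeq, h1, h2, h3]
  · set k := r + s.len * (N + 1) with hk
    have hkN : N + 1 ≤ k := by nlinarith
    refine ⟨k * k * s.len, fun m hm hmN hmr => ?_⟩
    have h1 : ¬ m < s.len := by nlinarith [Nat.mul_le_mul hkN hkN]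
    have h2 : k * k ≤ m / s.len := (Nat.le_div_iff_mul_le hL).2 hm
    have h3 : m / s.len < (k + 1) * (k + 1) := by
      rw [Nat.div_lt_iff_lt_mul hL]
      nlinarith
    have h4 : Nat.sqrt (m / s.len) = k := (Nat.eq_sqrt.2 ⟨h2, h3⟩).symm
    have h5 : k % s.len = r := by rw [hk, Nat.add_mul_mod_self_left, Nat.mod_eq_of_lt hr]
    simp [h1, h4, h5, hmr, hu r hr]

/-- The concatenations of `t` words of `s`, one of which is the distinguished word. -/
def concat (s : WordFamily) (t : ℕ) : Set (ℕ → Bool) :=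
  {u | (∀ q < t, shiftSeq (q * s.len) u ∈ s.words) ∧
    ∃ q < t, ∀ i < s.len, u (q * s.len + i) = s.base i}

/-- `s'` refines `s`: its words are concatenations of words of `s`, and all of them contain
the distinguished word of `s`. -/
def Refines (s' s : WordFamily) : Prop :=
  ∃ t, 2 ≤ t ∧ s'.len = t * s.len ∧ s'.words = s.concat t ∧
    ∀ i < s.len, s'.base i = s.base i

theorem block_index_lt {q t L i : ℕ} (hq : q < t) (hi : i < L) : q * L + i < t * L := by
  nlinarith

theorem exists_refines (s : WordFamily) {G : Set (Set ℕ)} (hG : CompactFamily G)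
    (hsub : ∀ A ∈ G, DynSyndetic A) :
    ∃ s' : WordFamily, s'.Refines s ∧
      ∀ x : ℕ → Bool, (∀ i < s'.len, x i = s'.base i) → {n | x n = true} ∉ G := by
  have hL := s.len_pos
  obtain ⟨b, hb0, hbW, hb⟩ := s.exists_not_dynSyndetic
  obtain ⟨M, hM⟩ := hG.exists_forall_agree_notMem (fun h => hb (hsub _ h))
  have hlen : M < (M + 2) * s.len := by nlinarith
  refine ⟨⟨(M + 2) * s.len, s.concat (M + 2), b, by positivity, ?_, ?_, ?_, ?_⟩,
    ⟨M + 2, by omega, rfl, rfl, hb0⟩, fun x hx => hM x fun i hi => hx i (by simp; omega)⟩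
  · rintro u ⟨huW, q, hq, hqu⟩ v hv
    refine ⟨fun q' hq' => s.saturated _ (huW q' hq') _ fun i hi =>
      hv _ (block_index_lt hq' hi), q, hq, fun i hi => ?_⟩
    rw [hv _ (block_index_lt hq hi), hqu i hi]
  · exact ⟨fun q _ => hbW q, 0, by omega, fun i hi => by simpa using hb0 i hi⟩
  · rw [hb0 0 hL, s.base_zero]
  · intro r hr
    obtain ⟨u, huW, hu⟩ := s.exists_false (r % s.len) (Nat.mod_lt r hL)
    have hdiv : ∀ q, ∀ i < s.len, (q * s.len + i) / s.len = q := fun q i hi => by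
      rw [mul_comm, Nat.mul_add_div hL, Nat.div_eq_of_lt hi, add_zero]
    have hmod : ∀ q, ∀ i < s.len, (q * s.len + i) % s.len = i := fun q i hi => by
      rw [mul_comm, Nat.mul_add_mod, Nat.mod_eq_of_lt hi]
    refine ⟨fun n => if n / s.len = r / s.len then u (n % s.len) else s.base (n % s.len),
      ⟨fun q _ => ?_, if r / s.len = 0 then 1 else 0, by split_ifs <;> omega,
        fun i hi => ?_⟩, by simp [hu]⟩
    · by_cases hq : q = r / s.len
      · refine s.saturated u huW _ fun i hi => ?_
        simp only [shiftSeq, hdiv q i hi, hmod q i hi, if_pos hq]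
      · refine s.saturated s.base s.base_mem _ fun i hi => ?_
        simp only [shiftSeq, hdiv q i hi, hmod q i hi, if_neg hq]
    · simp only [hdiv _ i hi, hmod _ i hi]
      split_ifs <;> first | rfl | omega

/-- The family of all words of length one. -/
def initial : WordFamily where
  len := 1
  words := univ
  base := fun _ => true
  len_pos := one_pos
  saturated := fun _ _ _ _ => mem_univ _
  base_mem := mem_univ _
  base_zero := rfl
  exists_false := fun _ _ => ⟨fun _ => false, mem_univ _, rfl⟩

variable {s : ℕ → WordFamily}

theorem lt_len (hs : ∀ m, (s (m + 1)).Refines (s m)) (m : ℕ) : m < (s m).len := by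
  induction m with
  | zero => exact (s 0).len_pos
  | succ m ih =>
    obtain ⟨t, ht, hlen, -⟩ := hs m
    rw [hlen]
    nlinarith

theorem len_mono (hs : ∀ m, (s (m + 1)).Refines (s m)) : Monotone fun m => (s m).len := by
  refine monotone_nat_of_le_succ fun m => ?_
  obtain ⟨t, ht, hlen, -⟩ := hs m
  rw [hlen]
  nlinarith

theorem base_eq (hs : ∀ m, (s (m + 1)).Refines (s m)) {m n : ℕ} (hmn : m ≤ n) :
    ∀ i < (s m).len, (s n).base i = (s m).base i := by
  induction n, hmn using Nat.le_induction with
  | base => exact fun _ _ => rfl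
  | succ n hmn ih =>
    intro i hi
    obtain ⟨t, -, -, -, h⟩ := hs n
    rw [h i (hi.trans_le (len_mono hs hmn)), ih i hi]

theorem shiftSeq_mem_words (hs : ∀ m, (s (m + 1)).Refines (s m)) {m n : ℕ} (hmn : m ≤ n) :
    ∀ u ∈ (s n).words, ∀ q, (q + 1) * (s m).len ≤ (s n).len →
      shiftSeq (q * (s m).len) u ∈ (s m).words := by
  induction n, hmn using Nat.le_induction with
  | base =>
    intro u hu q hq
    have hL := (s m).len_pos
    have : q = 0 := by nlinarith
    subst this
    exact (s m).saturated u hu _ fun i _ => by simp [shiftSeq]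
  | succ n hmn ih =>
    intro u hu q hq
    obtain ⟨t, ht, hlen, hwords, -⟩ := hs n
    rw [hwords] at hu
    obtain ⟨d, hd⟩ : (s m).len ∣ (s n).len := by
      clear ih hq hlen hwords hu
      induction n, hmn using Nat.le_induction with
      | base => exact dvd_rfl
      | succ n hmn ih =>
        obtain ⟨t', -, hlen', -⟩ := hs n
        exact hlen' ▸ ih.mul_left t'
    have hL := (s m).len_pos
    have hdpos : 0 < d := by
      have := (s n).len_pos
      rw [hd] at this
      exact pos_of_mul_pos_right this hL.le
    have hq1 : q + 1 ≤ t * d := by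
      rw [hlen, hd] at hq
      have : (q + 1) * (s m).len ≤ (t * d) * (s m).len := by linarith
      exact Nat.le_of_mul_le_mul_right this hL
    have hqd : q / d < t := (Nat.div_lt_iff_lt_mul hdpos).2 hq1
    have hmod := Nat.mod_lt q hdpos
    have h := ih _ (hu.1 (q / d) hqd) (q % d) (by rw [hd, mul_comm]; gcongr; omega)
    convert h using 1
    funext i
    simp only [shiftSeq]
    congr 1
    rw [hd]
    nth_rewrite 1 [← Nat.div_add_mod q d]
    ring

theorem uniformlyRecurrent (hs : ∀ m, (s (m + 1)).Refines (s m)) {x : ℕ → Bool}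
    (hx : ∀ m, ∀ i < (s m).len, x i = (s m).base i) : UniformlyRecurrent x := by
  intro n
  obtain ⟨t, -, hlen, hwords, -⟩ := hs n
  set L := (s (n + 1)).len with hLdef
  have hL : 0 < L := (s (n + 1)).len_pos
  refine ⟨2 * L, fun a => ?_⟩
  set q := a / L + 1 with hq
  have hblock : shiftSeq (q * L) x ∈ (s (n + 1)).words := by
    set N := (q + 1) * L with hN
    have hle : n + 1 ≤ N + (n + 1) := by omega
    refine shiftSeq_mem_words hs hle x ((s _).saturated _ (s _).base_mem x (hx _)) q ?_
    exact (Nat.le_add_right _ _).trans (lt_len hs (N + (n + 1))).le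
  rw [hwords] at hblock
  obtain ⟨-, q', hq', hbase⟩ := hblock
  have h1 := Nat.div_add_mod a L
  have h2 := Nat.mod_lt a hL
  have h3 : q * L = L * (a / L) + L := by rw [hq]; ring
  have h4 : q' * (s n).len ≤ L := by rw [hlen]; gcongr
  refine ⟨q * L + q' * (s n).len - a, by omega, fun i hi => ?_⟩
  have hi' : i < (s n).len := hi.trans (lt_len hs n)
  rw [hx n i hi', ← hbase i hi', shiftSeq]
  congr 1
  omega

end WordFamily

/-- Countably many compact families of dynamically syndetic sets do not cover the
dynamically central syndetic sets. -/
theorem exists_dynCentralSyndetic_notMem {Gs : ℕ → Set (Set ℕ)}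
    (hG : ∀ n, CompactFamily (Gs n)) (hsub : ∀ n, ∀ A ∈ Gs n, DynSyndetic A) :
    ∃ A, DynCentralSyndetic A ∧ ∀ n, A ∉ Gs n := by
  choose next hnext havoid using fun n (s : WordFamily) => s.exists_refines (hG n) (hsub n)
  let s : ℕ → WordFamily := fun m => Nat.rec WordFamily.initial next m
  have hs : ∀ m, (s (m + 1)).Refines (s m) := fun m => hnext m (s m)
  let x : ℕ → Bool := fun i => (s i).base i
  have hx : ∀ m, ∀ i < (s m).len, x i = (s m).base i := by
    intro m i hi
    rcases le_total m i with h | h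
    · exact WordFamily.base_eq hs h i hi
    · exact (WordFamily.base_eq hs h i (WordFamily.lt_len hs i)).symm
  exact ⟨_, (WordFamily.uniformlyRecurrent hs hx).dynCentralSyndetic (s 0).base_zero,
    fun n => havoid n (s n) x (hx (n + 1))⟩

/-! ### Duality -/

/-- If members of `F` and `G` always meet, and the complement of any set outside `F` belongs
to `G`, then `F` is the dual of `G`. -/
theorem eq_dualFamily {F G : Set (Set ℕ)} (hmeet : ∀ A ∈ F, ∀ B ∈ G, (B ∩ A).Nonempty)
    (hcompl : ∀ A ∉ F, Aᶜ ∈ G) : F = dualFamily G := by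
  refine Subset.antisymm hmeet fun A hA => ?_
  by_contra hcon
  simpa using hA _ (hcompl A hcon)

theorem dynSyndetic_dynCentralSyndetic_not_sigmaCompact :
    {A : Set ℕ | DynSyndetic A} = dualFamily {A : Set ℕ | DynThick A} ∧
    {A : Set ℕ | DynCentralSyndetic A} = dualFamily {A : Set ℕ | PointwiseRecurrent A} ∧
    ¬ SigmaCompactFamily {A : Set ℕ | DynSyndetic A} ∧
    ¬ SigmaCompactFamily {A : Set ℕ | DynCentralSyndetic A} := by
  refine ⟨eq_dualFamily ?_ ?_, eq_dualFamily ?_ ?_, ?_, ?_⟩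
  · rintro A ⟨S, hS, x, U, hU, hne, hR⟩ B hB
    obtain ⟨n, hnB, hn⟩ := hB S hS x U hU hne
    exact ⟨n, hnB, hR hn⟩
  · intro A hA S hS x U hU hne
    by_contra! hcon
    exact hA ⟨S, hS, x, U, hU, hne, fun n hn => by_contra fun h => hcon n h hn.1 hn.2⟩
  · rintro A ⟨S, hS, x, U, hU, hx, hR⟩ B hB
    obtain ⟨n, hnB, hn⟩ := hB S hS x U hU hx
    exact ⟨n, hnB, hR hn⟩
  · intro A hA S hS x U hU hx
    by_contra! hcon
    exact hA ⟨S, hS, x, U, hU, hx, fun n hn => by_contra fun h => hcon n h hn.1 hn.2⟩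
  · rintro ⟨Gs, hG, hU⟩
    obtain ⟨A, hA, hnot⟩ := exists_dynCentralSyndetic_notMem hG fun n A hA =>
      (hU ▸ mem_iUnion_of_mem n hA : A ∈ {A : Set ℕ | DynSyndetic A})
    obtain ⟨n, hn⟩ := mem_iUnion.1 (hU ▸ hA.dynSyndetic : A ∈ ⋃ n, Gs n)
    exact hnot n hn
  · rintro ⟨Gs, hG, hU⟩
    obtain ⟨A, hA, hnot⟩ := exists_dynCentralSyndetic_notMem hG fun n A hA =>
      (hU ▸ mem_iUnion_of_mem n hA : A ∈ {A : Set ℕ | DynCentralSyndetic A}).dynSyndetic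
    obtain ⟨n, hn⟩ := mem_iUnion.1 (hU ▸ hA : A ∈ ⋃ n, Gs n)
    exact hnot n hn
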